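/- arXiv:2106.14514 — 2 statements merged into one kernel-verified Lean document; each statement's English description precedes it below -/
import Mathlib

section
/- For every p ∈ ℝ³ with p ≠ 0, the field intensity obeys the two-sided bound 1/(4π‖p‖³) ≤ ‖h(p)‖ ≤ 1/(2π‖p‖³). -/
open Matrix Filter Topology

noncomputable section

/-- `e₁ = (1,0,0)ᵀ ∈ ℝ³`. -/
def e1 : Fin 3 → ℝ := ![1, 0, 0]

/-- Euclidean norm on `ℝ³`. -/
def norm3 (p : Fin 3 → ℝ) : ℝ := Real.sqrt (p ⬝ᵥ p)

/-- `R ∈ SO(3)`: `RᵀR = I₃` and `det R = 1`. -/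
def SO3 (R : Matrix (Fin 3) (Fin 3) ℝ) : Prop := Rᵀ * R = 1 ∧ R.det = 1

/-- `A(p) = 3 p pᵀ − ‖p‖² I₃`. -/
def A3 (p : Fin 3 → ℝ) : Matrix (Fin 3) (Fin 3) ℝ :=
  (3 : ℝ) • Matrix.vecMulVec p p - norm3 p ^ 2 • (1 : Matrix (Fin 3) (Fin 3) ℝ)

/-- Dipole magnetic field `h(p) = (1/(4π‖p‖⁵)) A(p) R e₁` (junk value at `p = 0`). -/
def hField (R : Matrix (Fin 3) (Fin 3) ℝ) (p : Fin 3 → ℝ) : Fin 3 → ℝ :=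
  (1 / (4 * Real.pi * norm3 p ^ 5)) • (A3 p).mulVec (R.mulVec e1)

/-- `M = Rᵀ e₁ e₁ᵀ R`. -/
def Mmat (R : Matrix (Fin 3) (Fin 3) ℝ) : Matrix (Fin 3) (Fin 3) ℝ :=
  Rᵀ * Matrix.vecMulVec e1 e1 * R

/-- Nominal conditioned intensity `h_n(p)`, with `h_n(0) = 0`. -/
def hn (R : Matrix (Fin 3) (Fin 3) ℝ) (p : Fin 3 → ℝ) : ℝ :=
  if p = 0 then 0 else
    (4 * Real.pi) ^ ((1 : ℝ) / 3) * norm3 p /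
      (1 + 3 * (p ⬝ᵥ (Mmat R).mulVec p) / norm3 p ^ 2) ^ ((1 : ℝ) / 6)

/-- For every `p ≠ 0`, `1/(4π‖p‖³) ≤ ‖h(p)‖ ≤ 1/(2π‖p‖³)`. -/
theorem dipole_intensity_two_sided_bound (R : Matrix (Fin 3) (Fin 3) ℝ) (hR : SO3 R)
    (p : Fin 3 → ℝ) (hp : p ≠ 0) :
    1 / (4 * Real.pi * norm3 p ^ 3) ≤ norm3 (hField R p) ∧
    norm3 (hField R p) ≤ 1 / (2 * Real.pi * norm3 p ^ 3) := by
  set u : Fin 3 → ℝ := R.mulVec e1 with hu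
  have huu : u ⬝ᵥ u = 1 := by
    rw [hu, Matrix.dotProduct_mulVec, Matrix.vecMul_mulVec, hR.1]
    simp [e1]
  have hN : 0 < p ⬝ᵥ p := by
    have h1 : 0 ≤ p ⬝ᵥ p := by
      simp only [dotProduct, Fin.sum_univ_three]; nlinarith [mul_self_nonneg (p 0), mul_self_nonneg (p 1), mul_self_nonneg (p 2)]
    have h2 : p ⬝ᵥ p ≠ 0 := fun h => hp (dotProduct_self_eq_zero.1 h)
    exact lt_of_le_of_ne h1 (Ne.symm h2)
  have hn : 0 < norm3 p := Real.sqrt_pos.2 hN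
  have hn2 : norm3 p ^ 2 = p ⬝ᵥ p := Real.sq_sqrt hN.le
  have hA : (A3 p).mulVec u = (3 * (p ⬝ᵥ u)) • p - (p ⬝ᵥ p) • u := by
    rw [A3, hn2, Matrix.sub_mulVec, Matrix.smul_mulVec, Matrix.smul_mulVec, Matrix.one_mulVec]
    ext i
    simp [Matrix.vecMulVec, Matrix.mulVec, dotProduct, Fin.sum_univ_three]
    ring
  have hAA : (A3 p).mulVec u ⬝ᵥ (A3 p).mulVec u
      = 3 * (p ⬝ᵥ p) * (p ⬝ᵥ u) ^ 2 + (p ⬝ᵥ p) ^ 2 := by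
    rw [hA]
    simp only [sub_dotProduct, dotProduct_sub, smul_dotProduct, dotProduct_smul, smul_eq_mul, huu,
      dotProduct_comm u p]
    ring
  have hcs : (p ⬝ᵥ u) ^ 2 ≤ p ⬝ᵥ p := by
    have h : (p ⬝ᵥ u) ^ 2 ≤ (p ⬝ᵥ p) * (u ⬝ᵥ u) := by
      simp only [dotProduct, Fin.sum_univ_three]
      nlinarith [sq_nonneg (p 0 * u 1 - p 1 * u 0), sq_nonneg (p 0 * u 2 - p 2 * u 0),
        sq_nonneg (p 1 * u 2 - p 2 * u 1)]
    rwa [huu, mul_one] at h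
  have hc : 0 < 1 / (4 * Real.pi * norm3 p ^ 5) := by positivity
  have hh : norm3 (hField R p) = 1 / (4 * Real.pi * norm3 p ^ 5) * norm3 ((A3 p).mulVec u) := by
    rw [hField, ← hu]
    generalize 1 / (4 * Real.pi * norm3 p ^ 5) = c at hc
    rw [norm3, norm3, smul_dotProduct, dotProduct_smul, smul_eq_mul, smul_eq_mul, ← mul_assoc,
      Real.sqrt_mul (by positivity), Real.sqrt_mul_self hc.le]
  have hlo : norm3 p ^ 2 ≤ norm3 ((A3 p).mulVec u) := by
    rw [hn2]
    apply Real.le_sqrt_of_sq_le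
    rw [hAA]
    have : 0 ≤ 3 * (p ⬝ᵥ p) * (p ⬝ᵥ u) ^ 2 := by positivity
    linarith
  have hhi : norm3 ((A3 p).mulVec u) ≤ 2 * norm3 p ^ 2 := by
    rw [hn2]
    apply Real.sqrt_le_iff.2 ⟨by positivity, _⟩
    rw [hAA]
    nlinarith [mul_le_mul_of_nonneg_left hcs hN.le]
  have hpi := Real.pi_pos
  rw [hh]
  constructor
  · calc 1 / (4 * Real.pi * norm3 p ^ 3)
        = 1 / (4 * Real.pi * norm3 p ^ 5) * norm3 p ^ 2 := by field_simp
      _ ≤ _ := mul_le_mul_of_nonneg_left hlo hc.le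
  · calc _ ≤ 1 / (4 * Real.pi * norm3 p ^ 5) * (2 * norm3 p ^ 2) :=
          mul_le_mul_of_nonneg_left hhi hc.le
      _ = 1 / (2 * Real.pi * norm3 p ^ 3) := by field_simp; norm_num
end
end

section
/- (Proposition 1, semiglobal practical uniform ultimate boundedness of the extremum seeking reference generator.) Let g : ℝ² → ℝ be continuously differentiable, radially unbounded, with a unique global minimizer q* = (x*, y*) which is also its only critical point. Then q* is (1/ω)-semiglobally practically uniformly ultimately bounded relative to the system ẋ(t) = √(αω) cos(ωt + κ g(x(t), y(t))), ẏ(t) = √(αω) sin(ωt + κ g(x(t), y(t))): for every ultimate bound δ > 0 and every compact set K ⊂ ℝ² of initial conditions, there exists c* > 0 such that for every κ, α > 0 with κα ≥ c* there exists ω* > 0 such that for every ω ≥ ω* and every solution (x, y) with (x(0), y(0)) ∈ K, there exists T ≥ 0 with ‖(x(t), y(t)) − q*‖ < δ for all t ≥ T. -/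
open Real Filter

lemma es_crossing (V : ℝ → ℝ) (hV : Continuous V) {a b c d : ℝ} (hab : a ≤ b) (hc : V a ≤ c)
    (hcd : c < d) (hd : d ≤ V b) :
    ∃ s u, a ≤ s ∧ s ≤ u ∧ V s = c ∧ V u = d ∧ ∀ t ∈ Set.Icc s u, c ≤ V t ∧ V t ≤ d := by
  have h1 : IsCompact (Set.Icc a b ∩ {t | d ≤ V t}) :=
    isCompact_Icc.inter_right (isClosed_le continuous_const hV)
  obtain ⟨u, ⟨⟨hau, hub⟩, hdu⟩, hul⟩ := h1.exists_isLeast ⟨b, ⟨hab, le_rfl⟩, hd⟩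
  simp only [Set.mem_ofPred_eq] at hdu
  have hVu : V u = d := by
    obtain ⟨t, ht, htd⟩ := intermediate_value_Icc hau hV.continuousOn
      (show d ∈ Set.Icc (V a) (V u) from ⟨by linarith, hdu⟩)
    have := hul ⟨⟨ht.1, ht.2.trans hub⟩, htd.ge⟩
    have : t = u := le_antisymm ht.2 this
    rw [← this, htd]
  have h2 : IsCompact (Set.Icc a u ∩ {t | V t ≤ c}) :=
    isCompact_Icc.inter_right (isClosed_le hV continuous_const)
  obtain ⟨s, ⟨⟨has, hsu⟩, hcs⟩, hsg⟩ := h2.exists_isGreatest ⟨a, ⟨le_rfl, hau⟩, hc⟩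
  simp only [Set.mem_ofPred_eq] at hcs
  have hVs : V s = c := by
    obtain ⟨t, ht, htd⟩ := intermediate_value_Icc hsu hV.continuousOn
      (show c ∈ Set.Icc (V s) (V u) from ⟨hcs, by linarith⟩)
    have := hsg ⟨⟨has.trans ht.1, ht.2⟩, htd.le⟩
    have : t = s := le_antisymm this ht.1
    rw [← this, htd]
  refine ⟨s, u, has, hsu, hVs, hVu, fun t ht => ⟨?_, ?_⟩⟩
  · by_contra! h
    have := hsg ⟨⟨has.trans ht.1, ht.2⟩, h.le⟩
    have : t = s := le_antisymm this ht.1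
    rw [this] at h; linarith
  · by_contra! h
    have := hul ⟨⟨has.trans ht.1, ht.2.trans hub⟩, h.le⟩
    have : t = u := le_antisymm ht.2 this
    rw [this] at h; linarith

lemma es_decay (L L' : ℝ → ℝ) (hL : ∀ t, HasDerivAt L (L' t) t) {s u μ : ℝ} (hsu : s ≤ u)
    (h : ∀ t ∈ Set.Icc s u, L' t ≤ -μ) : L u - L s ≤ -μ * (u - s) := by
  refine (convex_Icc s u).image_sub_le_mul_sub_of_deriv_le
    (fun t _ => (hL t).continuousAt.continuousWithinAt)
    (fun t _ => (hL t).differentiableAt.differentiableWithinAt) ?_ s ⟨le_rfl, hsu⟩ u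
    ⟨hsu, le_rfl⟩ hsu
  intro t ht
  rw [(hL t).deriv]
  exact h t (interior_subset ht)

lemma es_abstract (V L L' : ℝ → ℝ) (hV : Continuous V) (hL : ∀ t, HasDerivAt L (L' t) t)
    {R ρ0 ρ μ : ℝ} (hρ : 0 < ρ) (hμ : 0 < μ) (hR : ρ0 ≤ R) (h0 : V 0 ≤ R)
    (hVL : ∀ t, V t ≤ R + 3 * ρ → |L t - V t| ≤ ρ)
    (hd : ∀ t, ρ0 ≤ V t → V t ≤ R + 3 * ρ → L' t ≤ -μ) :
    ∃ T ≥ (0 : ℝ), ∀ t ≥ T, V t ≤ ρ0 + 3 * ρ := by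
  have key : ∀ c t0, ρ0 ≤ c → c ≤ R → V t0 ≤ c → ∀ t ≥ t0, V t ≤ c + 3 * ρ := by
    intro c t0 hc1 hc2 h t ht
    by_contra! hlt
    obtain ⟨s, u, _, hsu, hs, hu, hmid⟩ := es_crossing V hV ht h (by linarith : c < c + 3 * ρ) hlt.le
    have h1 := es_decay L L' hL (μ := μ) hsu
      (fun r hr => hd r (by linarith [(hmid r hr).1]) (by linarith [(hmid r hr).2]))
    have h2 := abs_le.1 (hVL s (by linarith))
    have h3 := abs_le.1 (hVL u (by linarith))
    have h4 : 0 ≤ μ * (u - s) := mul_nonneg hμ.le (by linarith)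
    linarith [h2.2, h3.1]
  have hall := key R 0 hR le_rfl h0
  have : ∃ T ≥ (0 : ℝ), V T ≤ ρ0 := by
    by_contra! hno
    have hT : ∃ T > 0, L 0 - μ * T < ρ0 - ρ := by
      refine ⟨(|L 0| + |ρ0| + ρ + 1) / μ, by positivity, ?_⟩
      rw [mul_div_cancel₀ _ hμ.ne']
      linarith [le_abs_self (L 0), neg_abs_le ρ0]
    obtain ⟨T, hT0, hT⟩ := hT
    have h1 := es_decay L L' hL (μ := μ) hT0.le
      (fun r hr => hd r (hno r hr.1).le (hall r hr.1))
    have h3 := abs_le.1 (hVL T (hall T hT0.le))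
    have := hno T hT0.le
    linarith [h3.1]
  obtain ⟨T, hT0, hT⟩ := this
  exact ⟨T, hT0, key ρ0 T le_rfl hR hT⟩

lemma es_pointwise {c s a1 b1 a2 b2 a3 b3 M η m k w : ℝ} (hcs : c ^ 2 + s ^ 2 = 1)
    (hM : 0 ≤ M) (hη : 0 ≤ η) (hk : 0 ≤ k)
    (ha1 : |a1| ≤ M) (hb1 : |b1| ≤ M) (ha2 : |a2| ≤ M) (hb2 : |b2| ≤ M) (ha3 : |a3| ≤ M)
    (hb3 : |b3| ≤ M) (ha12 : |a1 - a2| ≤ η) (hb12 : |b1 - b2| ≤ η) (ha13 : |a1 - a3| ≤ η)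
    (hb13 : |b1 - b3| ≤ η) (hm : 8 * m ≤ a1 ^ 2 + b1 ^ 2) (hMη : 14 * M * η ≤ m)
    (hkm : 8 * M ^ 3 * k ≤ m) (hw : w ≤ m) :
    -(c * a1 + s * b1) * (c * a2 + s * b2) +
      ((c * a3 + s * b3) ^ 2 - (a3 ^ 2 + b3 ^ 2) / 2) * (1 + k * (c * a2 + s * b2)) + w ≤ -m := by
  have hc : |c| ≤ 1 := (sq_le_one_iff_abs_le_one c).1 (by nlinarith [sq_nonneg c, sq_nonneg s])
  have hs : |s| ≤ 1 := (sq_le_one_iff_abs_le_one s).1 (by nlinarith [sq_nonneg c, sq_nonneg s])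
  have lin : ∀ a b N, |a| ≤ N → |b| ≤ N → |c * a + s * b| ≤ 2 * N := by
    intro a b N ha hb
    calc |c * a + s * b| ≤ |c * a| + |s * b| := abs_add_le _ _
      _ = |c| * |a| + |s| * |b| := by rw [abs_mul, abs_mul]
      _ ≤ 1 * N + 1 * N := by gcongr
      _ = 2 * N := by ring
  have hA := lin a1 b1 M ha1 hb1
  have hB := lin a2 b2 M ha2 hb2
  have hC := lin a3 b3 M ha3 hb3
  have hAB := lin _ _ η ha12 hb12
  have hAC := lin _ _ η ha13 hb13
  have e1 : c * (a1 - a2) + s * (b1 - b2) = (c * a1 + s * b1) - (c * a2 + s * b2) := by ring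
  have e2 : c * (a1 - a3) + s * (b1 - b3) = (c * a1 + s * b1) - (c * a3 + s * b3) := by ring
  rw [e1] at hAB
  rw [e2] at hAC
  generalize c * a1 + s * b1 = A at *
  generalize c * a2 + s * b2 = B at *
  generalize c * a3 + s * b3 = C at *
  have t1 : A * (A - B) ≤ 2 * M * (2 * η) := by
    refine (le_abs_self _).trans ?_
    rw [abs_mul]; gcongr
  have t2 : -((A - C) * (A + C)) ≤ 2 * η * (4 * M) := by
    refine (neg_le_abs _).trans ?_
    rw [abs_mul]; gcongr
    exact (abs_add_le _ _).trans (by linarith)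
  have t3 : (a1 - a3) * (a1 + a3) ≤ η * (2 * M) := by
    refine (le_abs_self _).trans ?_
    rw [abs_mul]; gcongr
    exact (abs_add_le _ _).trans (by linarith)
  have t4 : (b1 - b3) * (b1 + b3) ≤ η * (2 * M) := by
    refine (le_abs_self _).trans ?_
    rw [abs_mul]; gcongr
    exact (abs_add_le _ _).trans (by linarith)
  have q1 : C ^ 2 ≤ (2 * M) ^ 2 := sq_le_sq' (abs_le.1 hC).1 (abs_le.1 hC).2
  have q2 : a3 ^ 2 ≤ M ^ 2 := sq_le_sq' (abs_le.1 ha3).1 (abs_le.1 ha3).2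
  have q3 : b3 ^ 2 ≤ M ^ 2 := sq_le_sq' (abs_le.1 hb3).1 (abs_le.1 hb3).2
  have t5 : |C ^ 2 - (a3 ^ 2 + b3 ^ 2) / 2| ≤ 4 * M ^ 2 := by
    rw [abs_le]; constructor <;> nlinarith [sq_nonneg C, sq_nonneg a3, sq_nonneg b3]
  have t6 : (C ^ 2 - (a3 ^ 2 + b3 ^ 2) / 2) * (k * B) ≤ 4 * M ^ 2 * (k * (2 * M)) := by
    refine (le_abs_self _).trans ?_
    rw [abs_mul, abs_mul, abs_of_nonneg hk]; gcongr
  linarith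

lemma es_osc {c s a b a' b' M N : ℝ} (hcs : c ^ 2 + s ^ 2 = 1) (hM : 0 ≤ M) (hN : 0 ≤ N)
    (ha : |a| ≤ M) (hb : |b| ≤ M) (ha' : |a'| ≤ N) (hb' : |b'| ≤ N) :
    |(a ^ 2 - b ^ 2) * (2 * s * c) - 2 * (a * b) * (c ^ 2 - s ^ 2)| ≤ 4 * M ^ 2 ∧
    (2 * a * a' - 2 * b * b') * (2 * s * c) - 2 * (a' * b + a * b') * (c ^ 2 - s ^ 2)
      ≤ 8 * M * N := by
  have h1 : |2 * s * c| ≤ 1 := by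
    rw [abs_le]; constructor <;> nlinarith [sq_nonneg (s + c), sq_nonneg (s - c)]
  have h2 : |c ^ 2 - s ^ 2| ≤ 1 := by
    rw [abs_le]; constructor <;> nlinarith [sq_nonneg s, sq_nonneg c]
  generalize 2 * s * c = S at *
  generalize c ^ 2 - s ^ 2 = D at *
  have q2 : a ^ 2 ≤ M ^ 2 := sq_le_sq' (abs_le.1 ha).1 (abs_le.1 ha).2
  have q3 : b ^ 2 ≤ M ^ 2 := sq_le_sq' (abs_le.1 hb).1 (abs_le.1 hb).2
  have p : ∀ u v U W : ℝ, 0 ≤ U → |u| ≤ U → |v| ≤ W → |u * v| ≤ U * W := by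
    intro u v U W hU hu hv
    rw [abs_mul]; gcongr
  constructor
  · have := p (a ^ 2 - b ^ 2) S (2 * M ^ 2) 1 (by positivity)
      (by rw [abs_le]; constructor <;> nlinarith [sq_nonneg a, sq_nonneg b]) h1
    have h3 := p (a * b) D (M * M) 1 (by positivity) (p a b M M hM ha hb) h2
    rw [abs_le] at *
    constructor <;> nlinarith
  · have h3 := abs_le.1 (p _ _ (M * N) 1 (by positivity) (p a a' M N hM ha ha') h1)
    have h4 := abs_le.1 (p _ _ (M * N) 1 (by positivity) (p b b' M N hM hb hb') h1)
    have h5 := abs_le.1 (p _ _ (M * N) 1 (by positivity) (p b a' M N hM hb ha') h2)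
    have h6 := abs_le.1 (p _ _ (M * N) 1 (by positivity) (p a b' M N hM ha hb') h2)
    nlinarith [h3.2, h4.1, h5.1, h6.1]

lemma es_fd (f : ℝ × ℝ → ℝ) (z : ℝ × ℝ) (u v : ℝ) :
    fderiv ℝ f z (u, v) = u * fderiv ℝ f z (1, 0) + v * fderiv ℝ f z (0, 1) := by
  have : ((u, v) : ℝ × ℝ) = u • ((1, 0) : ℝ × ℝ) + v • ((0, 1) : ℝ × ℝ) := by
    ext <;> simp
  rw [this, map_add, map_smul, map_smul]; simp

lemma es_deriv (g G1 G2 : ℝ × ℝ → ℝ) (hg : Differentiable ℝ g) (hG1 : Differentiable ℝ G1)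
    (hG2 : Differentiable ℝ G2) {κ α ω σ ε : ℝ} (hω : 0 < ω) (h1 : ε * ω = σ) (h2 : ε * σ = α)
    (x y : ℝ → ℝ)
    (hx : ∀ t, HasDerivAt x (σ * Real.cos (ω * t + κ * g (x t, y t))) t)
    (hy : ∀ t, HasDerivAt y (σ * Real.sin (ω * t + κ * g (x t, y t))) t)
    (c s : ℝ → ℝ) (hc : c = fun t => Real.cos (ω * t + κ * g (x t, y t)))
    (hs : s = fun t => Real.sin (ω * t + κ * g (x t, y t)))
    (z : ℝ → ℝ × ℝ) (hz : z = fun t => (x t - ε * s t, y t + ε * c t))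
    (B : ℝ → ℝ) (hB : B = fun t => c t * fderiv ℝ g (x t, y t) (1, 0)
      + s t * fderiv ℝ g (x t, y t) (0, 1))
    (z' : ℝ → ℝ × ℝ) (hz' : z' = fun t => (-(κ * α) * (c t * B t), -(κ * α) * (s t * B t))) (t : ℝ) :
    HasDerivAt z (z' t) t ∧
    HasDerivAt (fun t => g (z t) + κ * α / (4 * ω) *
      ((G1 (z t) ^ 2 - G2 (z t) ^ 2) * (2 * s t * c t)
        - 2 * (G1 (z t) * G2 (z t)) * (c t ^ 2 - s t ^ 2)))
      (κ * α * (-(c t * fderiv ℝ g (z t) (1, 0) + s t * fderiv ℝ g (z t) (0, 1)) * B t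
        + ((c t * G1 (z t) + s t * G2 (z t)) ^ 2 - (G1 (z t) ^ 2 + G2 (z t) ^ 2) / 2)
          * (1 + κ * ε * B t)
        + 1 / (4 * ω) * ((2 * G1 (z t) * fderiv ℝ G1 (z t) (z' t)
            - 2 * G2 (z t) * fderiv ℝ G2 (z t) (z' t)) * (2 * s t * c t)
          - 2 * (fderiv ℝ G1 (z t) (z' t) * G2 (z t) + G1 (z t) * fderiv ℝ G2 (z t) (z' t))
            * (c t ^ 2 - s t ^ 2)))) t := by
  have hcs : c t ^ 2 + s t ^ 2 = 1 := by rw [hc, hs]; exact Real.cos_sq_add_sin_sq _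
  have hx' : HasDerivAt x (σ * c t) t := by rw [hc]; exact hx t
  have hy' : HasDerivAt y (σ * s t) t := by rw [hs]; exact hy t
  have hgq : HasDerivAt (fun t => g (x t, y t)) (σ * B t) t := by
    have := (hg (x t, y t)).hasFDerivAt.comp_hasDerivAt t (hx'.prodMk hy')
    refine this.congr_deriv ?_
    rw [es_fd, hB]; ring
  have hθ : HasDerivAt (fun t => ω * t + κ * g (x t, y t)) (ω + κ * (σ * B t)) t := by
    exact (((hasDerivAt_id t).const_mul ω).add (hgq.const_mul κ)).congr_deriv (by ring)
  have hc' : HasDerivAt c (-s t * (ω + κ * (σ * B t))) t := by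
    rw [hc, hs]; exact hθ.cos
  have hs' : HasDerivAt s (c t * (ω + κ * (σ * B t))) t := by
    rw [hc, hs]; exact hθ.sin
  have hzd : HasDerivAt z (z' t) t := by
    rw [hz]
    refine ((hx'.sub (hs'.const_mul ε)).prodMk (hy'.add (hc'.const_mul ε))).congr_deriv ?_
    rw [hz']
    ext
    · show σ * c t - ε * (c t * (ω + κ * (σ * B t))) = -(κ * α) * (c t * B t)
      rw [← h2, ← h1]; ring
    · show σ * s t + ε * (-s t * (ω + κ * (σ * B t))) = -(κ * α) * (s t * B t)
      rw [← h2, ← h1]; ring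
  refine ⟨hzd, ?_⟩
  have dg := (hg (z t)).hasFDerivAt.comp_hasDerivAt t hzd
  have d1 := (hG1 (z t)).hasFDerivAt.comp_hasDerivAt t hzd
  have d2 := (hG2 (z t)).hasFDerivAt.comp_hasDerivAt t hzd
  have e0 : fderiv ℝ g (z t) (z' t) = -(κ * α) *
      ((c t * fderiv ℝ g (z t) (1, 0) + s t * fderiv ℝ g (z t) (0, 1)) * B t) := by
    rw [hz', es_fd]; ring
  rw [e0] at dg
  have D := dg.add (((((d1.pow 2).sub (d2.pow 2)).mul ((hs'.const_mul 2).mul hc')).sub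
    (((d1.mul d2).const_mul 2).mul ((hc'.pow 2).sub (hs'.pow 2)))).const_mul (κ * α / (4 * ω)))
  refine D.congr_deriv ?_
  clear D dg d1 d2 e0
  simp only [Function.comp_apply, Pi.mul_apply, Pi.pow_apply, Pi.sub_apply]
  generalize fderiv ℝ G1 (z t) (z' t) = a'
  generalize fderiv ℝ G2 (z t) (z' t) = b'
  generalize G1 (z t) = a
  generalize G2 (z t) = b
  generalize c t * fderiv ℝ g (z t) (1, 0) + s t * fderiv ℝ g (z t) (0, 1) = A
  generalize c t = C at *
  generalize s t = S at *
  generalize B t = b0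
  rw [← h1]
  have hS : (C * a + S * b) ^ 2 - (a ^ 2 + b ^ 2) / 2
      = (a ^ 2 - b ^ 2) * (C ^ 2 - S ^ 2) / 2 + 2 * a * b * C * S := by
    linear_combination (a ^ 2 + b ^ 2) / 2 * hcs
  rw [hS]
  field_simp
  push_cast
  ring

lemma es_max_bound (f : ℝ × ℝ → ℝ) (hf : Continuous f) (S : Set (ℝ × ℝ)) (hS : IsCompact S) :
    ∃ M ≥ (0 : ℝ), ∀ z ∈ S, |f z| ≤ M := by
  obtain ⟨M, hM⟩ := hS.exists_bound_of_continuousOn hf.continuousOn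
  exact ⟨max M 0, le_max_right _ _, fun z hz => (hM z hz).trans (le_max_left _ _)⟩

set_option maxHeartbeats 4000000 in
/-- Proposition 1: semiglobal practical uniform ultimate boundedness of the
extremum seeking reference generator. Let `g : ℝ² → ℝ` be continuously differentiable,
radially unbounded, with a unique global minimizer `q* = (x*, y*)` which is also its only
critical point. Then for every ultimate bound `δ > 0` and every compact set `K ⊆ ℝ²` of
initial conditions there exists `c* > 0` such that for every `κ, α > 0` with `κα ≥ c*`
there exists `ω* > 0` such that for every `ω ≥ ω*` and every solution `(x, y)` of
`ẋ = √(αω) cos(ωt + κ g(x,y))`, `ẏ = √(αω) sin(ωt + κ g(x,y))` with `(x(0), y(0)) ∈ K`,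
there exists `T ≥ 0` with `‖(x(t), y(t)) − q*‖ < δ` for all `t ≥ T`. -/
theorem es_semiglobal_practical_uub (g : ℝ × ℝ → ℝ) (hg : ContDiff ℝ 1 g)
    (qstar : ℝ × ℝ)
    (hradial : Tendsto g (cocompact (ℝ × ℝ)) atTop)
    (hmin : ∀ q : ℝ × ℝ, q ≠ qstar → g qstar < g q)
    (hcrit : ∀ q : ℝ × ℝ, fderiv ℝ g q = 0 → q = qstar) :
    ∀ δ > (0 : ℝ), ∀ K : Set (ℝ × ℝ), IsCompact K →
      ∃ cstar > (0 : ℝ), ∀ κ α : ℝ, 0 < κ → 0 < α → cstar ≤ κ * α →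
        ∃ ωstar > (0 : ℝ), ∀ ω ≥ ωstar,
          ∀ x y : ℝ → ℝ,
            (∀ t, HasDerivAt x (Real.sqrt (α * ω) * Real.cos (ω * t + κ * g (x t, y t))) t) →
            (∀ t, HasDerivAt y (Real.sqrt (α * ω) * Real.sin (ω * t + κ * g (x t, y t))) t) →
            (x 0, y 0) ∈ K →
            ∃ T ≥ (0 : ℝ), ∀ t ≥ T,
              Real.sqrt ((x t - qstar.1) ^ 2 + (y t - qstar.2) ^ 2) < δ := by
  intro δ hδ K hK
  have hgc : Continuous g := hg.continuous
  have hgd : Differentiable ℝ g := hg.differentiable (by norm_num)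
  have hsub : ∀ R : ℝ, IsCompact {z | g z ≤ R} := by
    intro R
    have := hradial.eventually (eventually_gt_atTop R)
    obtain ⟨t, ht, hts⟩ := Filter.mem_cocompact.1 this
    refine ht.of_isClosed_subset (isClosed_le hgc continuous_const) ?_
    intro z hz
    by_contra hzt
    have h1 : R < g z := hts hzt
    have h2 : g z ≤ R := hz
    linarith
  -- the level `ρ`
  have hρ : ∃ ρ > 0, ∀ z, g z ≤ g qstar + 2 * ρ → dist z qstar < δ / 4 := by
    have hc : IsCompact ({z | g z ≤ g qstar + 1} ∩ {z | δ / 4 ≤ dist z qstar}) :=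
      (hsub _).inter_right (isClosed_le continuous_const (by fun_prop))
    obtain ⟨v, hv, hvm⟩ := hc.exists_forall_le' (a := g qstar) hgc.continuousOn (by
      rintro z ⟨_, hz⟩
      refine hmin z ?_
      rintro rfl
      have hz' : δ / 4 ≤ dist z z := hz
      rw [dist_self] at hz'
      linarith)
    refine ⟨min (1 / 2) ((v - g qstar) / 4), lt_min (by norm_num) (by linarith), ?_⟩
    intro z hz
    by_contra! hzd
    have m1 := min_le_left (1 / 2) ((v - g qstar) / 4)
    have m2 := min_le_right (1 / 2) ((v - g qstar) / 4)
    have h1 : g z ≤ g qstar + 1 := by linarith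
    have := hvm z ⟨h1, hzd⟩
    linarith
  obtain ⟨ρ, hρ0, hρ⟩ := hρ
  obtain ⟨R0, _, hR0⟩ := es_max_bound g hgc _ (hK.cthickening (r := 1))
  obtain ⟨R, hR⟩ : ∃ R, R = max R0 (g qstar + ρ) := ⟨_, rfl⟩
  have hRR0 : R0 ≤ R := hR ▸ le_max_left _ _
  have hRρ : g qstar + ρ ≤ R := hR ▸ le_max_right _ _
  obtain ⟨D, hD⟩ : ∃ D : Set (ℝ × ℝ), D = {z | g z ≤ R + 3 * (ρ / 3)} := ⟨_, rfl⟩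
  have hDm : ∀ z, z ∈ D ↔ g z ≤ R + 3 * (ρ / 3) := fun z => by rw [hD]; rfl
  have hDc : IsCompact D := hD ▸ hsub _
  obtain ⟨p, hp⟩ : ∃ p : ℝ × ℝ → ℝ, p = fun z => fderiv ℝ g z (1, 0) := ⟨_, rfl⟩
  obtain ⟨r, hr⟩ : ∃ r : ℝ × ℝ → ℝ, r = fun z => fderiv ℝ g z (0, 1) := ⟨_, rfl⟩
  have hfc : Continuous (fderiv ℝ g) := hg.continuous_fderiv (by norm_num)
  have hpc : Continuous p := by rw [hp]; exact hfc.clm_apply continuous_const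
  have hrc : Continuous r := by rw [hr]; exact hfc.clm_apply continuous_const
  have hD'c : IsCompact (Metric.cthickening 1 D) := hDc.cthickening
  have hDD' : D ⊆ Metric.cthickening 1 D := Metric.self_subset_cthickening D
  obtain ⟨M1, hM1, hpM⟩ := es_max_bound p hpc _ hD'c
  obtain ⟨M2, hM2, hrM⟩ := es_max_bound r hrc _ hD'c
  obtain ⟨M, hM⟩ : ∃ M, M = M1 + M2 + 1 := ⟨_, rfl⟩
  have hM0 : 0 < M := by linarith
  -- gradient bounded below
  have hm : ∃ m > 0, ∀ z ∈ D, g qstar + ρ ≤ g z → 8 * m ≤ p z ^ 2 + r z ^ 2 := by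
    have hc : IsCompact (D ∩ {z | g qstar + ρ ≤ g z}) :=
      hDc.inter_right (isClosed_le continuous_const hgc)
    obtain ⟨v, hv, hvm⟩ := hc.exists_forall_le' (a := 0) (f := fun z => p z ^ 2 + r z ^ 2)
      (by fun_prop) (by
        rintro z ⟨_, hz⟩
        have hz' : g qstar + ρ ≤ g z := hz
        by_contra! hle
        have h1 : p z = 0 := by nlinarith [sq_nonneg (p z), sq_nonneg (r z)]
        have h2 : r z = 0 := by nlinarith [sq_nonneg (p z), sq_nonneg (r z)]
        have : z = qstar := by
          apply hcrit
          ext1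
          · ext
            simpa [hp] using h1
          · ext
            simpa [hr] using h2
        rw [this] at hz'
        linarith)
    exact ⟨v / 8, by linarith, fun z hz hz' => by linarith [hvm z ⟨hz, hz'⟩]⟩
  obtain ⟨m, hm0, hm⟩ := hm
  obtain ⟨η, hη⟩ : ∃ η, η = min 1 (m / (14 * M)) := ⟨_, rfl⟩
  have hη0 : 0 < η := by rw [hη]; positivity
  have hη1 : η ≤ 1 := hη ▸ min_le_left _ _
  have hηm : 14 * M * η ≤ m := by
    have : η ≤ m / (14 * M) := hη ▸ min_le_right _ _
    rw [le_div_iff₀ (by positivity)] at this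
    linarith
  obtain ⟨d1, hd1, hpu⟩ := Metric.uniformContinuousOn_iff.1
    (hD'c.uniformContinuousOn_of_continuous hpc.continuousOn) η hη0
  obtain ⟨d2, hd2, hru⟩ := Metric.uniformContinuousOn_iff.1
    (hD'c.uniformContinuousOn_of_continuous hrc.continuousOn) η hη0
  obtain ⟨G1, hG1, hG1p, _⟩ := hpc.exists_contDiff_approx 1 (ε := fun _ => η) continuous_const
    (fun _ => hη0)
  obtain ⟨G2, hG2, hG2r, _⟩ := hrc.exists_contDiff_approx 1 (ε := fun _ => η) continuous_const
    (fun _ => hη0)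
  obtain ⟨N1, hN1⟩ := hDc.exists_bound_of_continuousOn
    (hG1.continuous_fderiv (by norm_num)).continuousOn
  obtain ⟨N2, hN2⟩ := hDc.exists_bound_of_continuousOn
    (hG2.continuous_fderiv (by norm_num)).continuousOn
  obtain ⟨N, hN⟩ : ∃ N, N = max (max N1 N2) 0 := ⟨_, rfl⟩
  have hN0 : 0 ≤ N := hN ▸ le_max_right _ _
  have hN1' : N1 ≤ N := hN ▸ (le_max_left _ _).trans (le_max_left _ _)
  have hN2' : N2 ≤ N := hN ▸ (le_max_right _ _).trans (le_max_left _ _)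
  refine ⟨1, one_pos, fun κ α hκ hα _ => ?_⟩
  have hκα : 0 < κ * α := mul_pos hκ hα
  obtain ⟨ε0, hε00, hε1, hεδ, hεd1, hεd2, hεm⟩ : ∃ ε0 > 0, ε0 ≤ 1 ∧ ε0 ≤ δ / 4 ∧ ε0 ≤ d1 / 2 ∧
      ε0 ≤ d2 / 2 ∧ ε0 ≤ m / (8 * M ^ 3 * κ) := by
    refine ⟨min (min (min 1 (δ / 4)) (min (d1 / 2) (d2 / 2))) (m / (8 * M ^ 3 * κ)),
      by positivity, ?_, ?_, ?_, ?_, min_le_right _ _⟩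
    · exact (min_le_left _ _).trans ((min_le_left _ _).trans (min_le_left _ _))
    · exact (min_le_left _ _).trans ((min_le_left _ _).trans (min_le_right _ _))
    · exact (min_le_left _ _).trans ((min_le_right _ _).trans (min_le_left _ _))
    · exact (min_le_left _ _).trans ((min_le_right _ _).trans (min_le_right _ _))
  refine ⟨α / ε0 ^ 2 + 4 * M ^ 2 * N * (κ * α) / m + M ^ 2 * (κ * α) / (ρ / 3), by positivity, ?_⟩
  intro ω hω x y hx hy h0
  have q1 : 0 < α / ε0 ^ 2 := by positivity
  have q2 : 0 ≤ 4 * M ^ 2 * N * (κ * α) / m := by positivity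
  have q3 : 0 ≤ M ^ 2 * (κ * α) / (ρ / 3) := by positivity
  have hω0 : 0 < ω := by linarith
  have w1 : α / ε0 ^ 2 ≤ ω := by linarith
  have w2 : 4 * M ^ 2 * N * (κ * α) / m ≤ ω := by linarith
  have w3 : M ^ 2 * (κ * α) / (ρ / 3) ≤ ω := by linarith
  rw [div_le_iff₀ (by positivity)] at w1 w2 w3
  obtain ⟨σ, hσ⟩ : ∃ σ, σ = Real.sqrt (α * ω) := ⟨_, rfl⟩
  rw [← hσ] at hx hy
  have hσ0 : 0 < σ := by rw [hσ]; positivity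
  have hσ2 : σ * σ = α * ω := by rw [hσ]; exact Real.mul_self_sqrt (by positivity)
  obtain ⟨ε, hε⟩ : ∃ ε, ε = σ / ω := ⟨_, rfl⟩
  have hε0 : 0 < ε := by rw [hε]; positivity
  have hεω : ε * ω = σ := by rw [hε]; field_simp
  have hεσ : ε * σ = α := by
    rw [hε]; field_simp; linarith
  have hεε : ε ≤ ε0 := by
    have : ε ^ 2 * ω ≤ ε0 ^ 2 * ω := by
      have : ε ^ 2 * ω = α := by rw [← hεσ, ← hεω]; ring
      linarith
    have := le_of_mul_le_mul_right this hω0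
    exact (pow_le_pow_iff_left₀ hε0.le hε00.le two_ne_zero).1 this
  obtain ⟨c, hc⟩ : ∃ c : ℝ → ℝ, c = fun t => Real.cos (ω * t + κ * g (x t, y t)) := ⟨_, rfl⟩
  obtain ⟨s, hs⟩ : ∃ s : ℝ → ℝ, s = fun t => Real.sin (ω * t + κ * g (x t, y t)) := ⟨_, rfl⟩
  obtain ⟨z, hz⟩ : ∃ z : ℝ → ℝ × ℝ, z = fun t => (x t - ε * s t, y t + ε * c t) := ⟨_, rfl⟩
  obtain ⟨B, hB⟩ : ∃ B : ℝ → ℝ, B = fun t => c t * fderiv ℝ g (x t, y t) (1, 0)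
      + s t * fderiv ℝ g (x t, y t) (0, 1) := ⟨_, rfl⟩
  obtain ⟨z', hz'⟩ : ∃ z' : ℝ → ℝ × ℝ,
      z' = fun t => (-(κ * α) * (c t * B t), -(κ * α) * (s t * B t)) := ⟨_, rfl⟩
  have hder := es_deriv g G1 G2 hgd (hG1.differentiable (by norm_num))
    (hG2.differentiable (by norm_num)) hω0 hεω hεσ x y hx hy c s hc hs z hz B hB z' hz'
  have hcs : ∀ t, c t ^ 2 + s t ^ 2 = 1 := fun t => by
    rw [hc, hs]; exact Real.cos_sq_add_sin_sq _
  have hc1 : ∀ t, |c t| ≤ 1 := fun t => by rw [hc]; exact Real.abs_cos_le_one _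
  have hs1 : ∀ t, |s t| ≤ 1 := fun t => by rw [hs]; exact Real.abs_sin_le_one _
  have hzq : ∀ t, dist (x t, y t) (z t) ≤ ε := by
    intro t
    rw [hz, Prod.dist_eq]
    refine max_le ?_ ?_
    · show dist (x t) (x t - ε * s t) ≤ ε
      rw [Real.dist_eq, show x t - (x t - ε * s t) = ε * s t by ring, abs_mul, abs_of_pos hε0]
      exact mul_le_of_le_one_right hε0.le (hs1 t)
    · show dist (y t) (y t + ε * c t) ≤ ε
      rw [Real.dist_eq, show y t - (y t + ε * c t) = -(ε * c t) by ring, abs_neg, abs_mul,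
        abs_of_pos hε0]
      exact mul_le_of_le_one_right hε0.le (hc1 t)
  have hq : ∀ t, z t ∈ D → (x t, y t) ∈ Metric.cthickening 1 D := fun t ht =>
    Metric.mem_cthickening_of_dist_le _ _ _ _ ht ((hzq t).trans (by linarith))
  have hzc : Continuous z := continuous_iff_continuousAt.2 fun t => (hder t).1.continuousAt
  have hGM1 : ∀ w ∈ D, |p w - G1 w| ≤ η ∧ |G1 w| ≤ M := by
    intro w hw
    have h1 := hG1p w
    rw [dist_comm, Real.dist_eq] at h1
    have h2 := hpM w (hDD' hw)
    refine ⟨h1.le, ?_⟩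
    rw [abs_le] at h2 ⊢
    rw [abs_lt] at h1
    constructor <;> linarith [h1.1, h1.2, h2.1, h2.2]
  have hGM2 : ∀ w ∈ D, |r w - G2 w| ≤ η ∧ |G2 w| ≤ M := by
    intro w hw
    have h1 := hG2r w
    rw [dist_comm, Real.dist_eq] at h1
    have h2 := hrM w (hDD' hw)
    refine ⟨h1.le, ?_⟩
    rw [abs_le] at h2 ⊢
    rw [abs_lt] at h1
    constructor <;> linarith [h1.1, h1.2, h2.1, h2.2]
  have hmain : ∃ T ≥ (0 : ℝ), ∀ t ≥ T, g (z t) ≤ (g qstar + ρ) + 3 * (ρ / 3) := by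
    refine es_abstract (fun t => g (z t)) _ _ (hgc.comp hzc) (fun t => (hder t).2)
      (R := R) (μ := κ * α * m) (by positivity) (by positivity) hRρ ?_ ?_ ?_
    · have : z 0 ∈ Metric.cthickening 1 K := by
        refine Metric.mem_cthickening_of_dist_le _ _ _ _ h0 ?_
        rw [dist_comm]
        exact (hzq 0).trans (by linarith)
      exact ((le_abs_self _).trans (hR0 _ this)).trans hRR0
    · intro t ht
      have hzD : z t ∈ D := (hDm _).2 ht
      have h1 := (es_osc (hcs t) hM0.le le_rfl (hGM1 _ hzD).2 (hGM2 _ hzD).2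
        (abs_zero (α := ℝ)).le (abs_zero (α := ℝ)).le).1
      rw [add_sub_cancel_left, abs_mul, abs_of_pos (by positivity)]
      calc κ * α / (4 * ω) * _ ≤ κ * α / (4 * ω) * (4 * M ^ 2) := by gcongr
        _ = M ^ 2 * (κ * α) / ω := by field_simp
        _ ≤ ρ / 3 := by rw [div_le_iff₀ hω0]; linarith
    · intro t ht1 ht
      have hzD : z t ∈ D := (hDm _).2 ht
      have hqD := hq t hzD
      have hzD' := hDD' hzD
      have hdist : dist (z t) (x t, y t) ≤ ε := by rw [dist_comm]; exact hzq t
      have hpq := hpu _ hzD' _ hqD (by linarith)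
      have hrq := hru _ hzD' _ hqD (by linarith)
      rw [Real.dist_eq] at hpq hrq
      have hp2 := hpM _ hqD
      have hr2 := hrM _ hqD
      have hBp : B t = c t * p (x t, y t) + s t * r (x t, y t) := by rw [hB, hp, hr]
      have hBM : |B t| ≤ 2 * M := by
        rw [hBp]
        calc _ ≤ |c t * p (x t, y t)| + |s t * r (x t, y t)| := abs_add_le _ _
          _ = |c t| * |p (x t, y t)| + |s t| * |r (x t, y t)| := by rw [abs_mul, abs_mul]
          _ ≤ 1 * M + 1 * M := by
            gcongr
            · exact hc1 t
            · linarith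
            · exact hs1 t
            · linarith
          _ = 2 * M := by ring
      have hz'n : ‖z' t‖ ≤ κ * α * (2 * M) := by
        rw [hz', Prod.norm_def]
        refine max_le ?_ ?_
        · show |(-(κ * α) * (c t * B t))| ≤ _
          rw [abs_mul, abs_neg, abs_of_pos hκα, abs_mul]
          exact mul_le_mul_of_nonneg_left
            ((mul_le_of_le_one_left (abs_nonneg _) (hc1 t)).trans hBM) hκα.le
        · show |(-(κ * α) * (s t * B t))| ≤ _
          rw [abs_mul, abs_neg, abs_of_pos hκα, abs_mul]
          exact mul_le_mul_of_nonneg_left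
            ((mul_le_of_le_one_left (abs_nonneg _) (hs1 t)).trans hBM) hκα.le
      have ha' : |fderiv ℝ G1 (z t) (z' t)| ≤ N * (κ * α * (2 * M)) := by
        refine ((fderiv ℝ G1 (z t)).le_opNorm (z' t)).trans ?_
        gcongr
        exact (hN1 _ hzD).trans hN1'
      have hb' : |fderiv ℝ G2 (z t) (z' t)| ≤ N * (κ * α * (2 * M)) := by
        refine ((fderiv ℝ G2 (z t)).le_opNorm (z' t)).trans ?_
        gcongr
        exact (hN2 _ hzD).trans hN2'
      have hosc := (es_osc (hcs t) hM0.le (by positivity) (hGM1 _ hzD).2 (hGM2 _ hzD).2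
        ha' hb').2
      have hw : 1 / (4 * ω) * ((2 * G1 (z t) * fderiv ℝ G1 (z t) (z' t)
            - 2 * G2 (z t) * fderiv ℝ G2 (z t) (z' t)) * (2 * s t * c t)
          - 2 * (fderiv ℝ G1 (z t) (z' t) * G2 (z t) + G1 (z t) * fderiv ℝ G2 (z t) (z' t))
            * (c t ^ 2 - s t ^ 2)) ≤ m := by
        calc _ ≤ 1 / (4 * ω) * (8 * M * (N * (κ * α * (2 * M)))) := by gcongr
          _ = 4 * M ^ 2 * N * (κ * α) / ω := by field_simp; ring
          _ ≤ m := by rw [div_le_iff₀ hω0]; linarith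
      have hk : 8 * M ^ 3 * (κ * ε) ≤ m := by
        have : ε ≤ m / (8 * M ^ 3 * κ) := hεε.trans hεm
        rw [le_div_iff₀ (by positivity)] at this
        linarith
      have hfin := es_pointwise (hcs t) hM0.le hη0.le (by positivity : 0 ≤ κ * ε)
        ((hpM _ hzD').trans (by linarith)) ((hrM _ hzD').trans (by linarith))
        (hp2.trans (by linarith)) (hr2.trans (by linarith)) (hGM1 _ hzD).2 (hGM2 _ hzD).2
        hpq.le hrq.le (hGM1 _ hzD).1 (hGM2 _ hzD).1 (hm _ hzD ht1) hηm hk hw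
      rw [← hBp, hp, hr] at hfin
      calc _ ≤ κ * α * (-m) := mul_le_mul_of_nonneg_left hfin hκα.le
        _ = -(κ * α * m) := by ring
  obtain ⟨T, hT0, hT⟩ := hmain
  refine ⟨T, hT0, fun t ht => ?_⟩
  have h1 := hρ (z t) (by linarith [hT t ht])
  have h2 : dist (x t, y t) qstar < δ / 2 := by
    have := dist_triangle (x t, y t) (z t) qstar
    linarith [hzq t]
  rw [Prod.dist_eq, max_lt_iff] at h2
  obtain ⟨h3, h4⟩ := h2
  rw [Real.dist_eq] at h3 h4
  rw [Real.sqrt_lt' hδ]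
  have h5 : (x t - qstar.1) ^ 2 < (δ / 2) ^ 2 := sq_lt_sq' (abs_lt.1 h3).1 (abs_lt.1 h3).2
  have h6 : (y t - qstar.2) ^ 2 < (δ / 2) ^ 2 := sq_lt_sq' (abs_lt.1 h4).1 (abs_lt.1 h4).2
  have h7 : 0 < δ ^ 2 := by positivity
  linarith
end
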